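/- (Balanced case.) Suppose 𝐝 = (d₁,…,d_m) is balanced, i.e., 2d_i < d for all i, where d = Σ_i d_i. Let n ≥ 3, let the F_i be in general position, let λ_i be pairwise distinct and nonzero with Σ_i d_i λ_i = 0, and set ω = Σ_i λ_i F̂_i dF_i. If α is a projective homogeneous polynomial 1-form of degree d with ω ∧ dα + α ∧ dω = 0, and α = Σ_i F̂_i γ_i for some homogeneous polynomial 1-forms γ_i of degree d_i, then there exists λ' ∈ ℂ^m with Σ_i d_i λ'_i = 0 such that α = Σ_{i=1}^m λ'_i F̂_i dF_i. In particular α lies in the image of the derivative dμ(λ, F). -/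

import Mathlib

open MvPolynomial Finset

namespace LogStab

/-- The polynomial ring `ℂ[x₀, …, x_{N-1}]`. -/
abbrev S (N : ℕ) : Type := MvPolynomial (Fin N) ℂ

/-- A polynomial 1-form `∑ₖ aₖ dxₖ` on `ℂ^N`, given by its coefficients `aₖ`. -/
abbrev Form1 (N : ℕ) : Type := Fin N → S N

/-- The differential `dF` of a polynomial, as a 1-form. -/
noncomputable def Dp {N : ℕ} (F : S N) : Form1 N := fun k => pderiv k F

/-- Exterior derivative of a 1-form: the antisymmetric coefficients of the 2-form `dω`,
`(dω)_{kl} = ∂ₖ ω_l - ∂_l ω_k`. -/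
noncomputable def extD {N : ℕ} (ω : Form1 N) : Fin N → Fin N → S N :=
  fun k l => pderiv k (ω l) - pderiv l (ω k)

/-- Wedge of two 1-forms: `(α ∧ β)_{kl} = αₖ β_l - α_l βₖ`. -/
noncomputable def w11 {N : ℕ} (α β : Form1 N) : Fin N → Fin N → S N :=
  fun k l => α k * β l - α l * β k

/-- Wedge of a 1-form and an (antisymmetric) 2-form: coefficients of the 3-form. -/
noncomputable def w12 {N : ℕ} (α : Form1 N) (β : Fin N → Fin N → S N) :
    Fin N → Fin N → Fin N → S N :=
  fun i j k => α i * β j k - α j * β i k + α k * β i j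

/-- Wedge of two (antisymmetric) 2-forms: coefficients of the 4-form. -/
noncomputable def w22 {N : ℕ} (β γ : Fin N → Fin N → S N) :
    Fin N → Fin N → Fin N → Fin N → S N :=
  fun i j k l =>
    β i j * γ k l - β i k * γ j l + β i l * γ j k + β j k * γ i l - β j l * γ i k + β k l * γ i j

/-- Contraction `⟨R, α⟩ = ∑ₖ xₖ aₖ` of a 1-form with the radial (Euler) vector field. -/
noncomputable def radial {N : ℕ} (α : Form1 N) : S N := ∑ k, X k * α k

/-- `α` is a homogeneous 1-form of degree `d`:
all its coefficients are homogeneous polynomials of degree `d - 1`. -/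
def IsHomog1 {N : ℕ} (α : Form1 N) (d : ℕ) : Prop := ∀ k, (α k).IsHomogeneous (d - 1)

/-- `F̂ᵢ = ∏_{j ≠ i} F_j`. -/
noncomputable def Fhat {N m : ℕ} (F : Fin m → S N) (i : Fin m) : S N :=
  ∏ j ∈ Finset.univ.erase i, F j

/-- `F̂ᵢⱼ = ∏_{k ≠ i, j} F_k`. -/
noncomputable def Fhat2 {N m : ℕ} (F : Fin m → S N) (i j : Fin m) : S N :=
  ∏ k ∈ (Finset.univ.erase i).erase j, F k

/-- The logarithmic 1-form `ω = μ(λ, F) = ∑ᵢ λᵢ F̂ᵢ dFᵢ`. -/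
noncomputable def logForm {N m : ℕ} (lam : Fin m → ℂ) (F : Fin m → S N) : Form1 N :=
  fun k => ∑ i, C (lam i) * Fhat F i * pderiv k (F i)

/-- The condition `ω ∧ dα + α ∧ dω = 0` (as a 3-form). -/
def TangentZero {N : ℕ} (ω α : Form1 N) : Prop :=
  ∀ i j k, w12 ω (extD α) i j k + w12 α (extD ω) i j k = 0

/-- The derivative of the multilinear map `μ` at `(λ, F)` in the direction `(λ', F')`:
`∑ᵢ λ'ᵢ F̂ᵢ dFᵢ + ∑_{i ≠ k} λᵢ F'ₖ F̂ᵢₖ dFᵢ + ∑ᵢ λᵢ F̂ᵢ dF'ᵢ`. -/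
noncomputable def dmu {N m : ℕ} (lam : Fin m → ℂ) (F : Fin m → S N)
    (lam' : Fin m → ℂ) (F' : Fin m → S N) : Form1 N :=
  fun k =>
    (∑ i, C (lam' i) * Fhat F i * pderiv k (F i)) +
    (∑ i, ∑ j ∈ Finset.univ.erase i, C (lam i) * F' j * Fhat2 F i j * pderiv k (F i)) +
    (∑ i, C (lam i) * Fhat F i * pderiv k (F' i))

/-- The `Fᵢ` are in general position: each `Fᵢ` is irreducible and at every nonzero point
of the cone the differentials of the `Fᵢ` vanishing there are linearly independent
(simple normal crossings; in particular each hypersurface is smooth). -/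
def GeneralPosition {N m : ℕ} (F : Fin m → S N) : Prop :=
  (∀ i, Irreducible (F i)) ∧
  ∀ x : Fin N → ℂ, x ≠ 0 →
    LinearIndependent ℂ (fun i : {i : Fin m // eval x (F i) = 0} =>
      (fun k => eval x (pderiv k (F i.1)) : Fin N → ℂ))

/-- A polynomial function on a complex vector space: an element of the subalgebra of
functions generated by the linear functionals. -/
def IsPolyFun {E : Type*} [AddCommGroup E] [Module ℂ E] (f : E → ℂ) : Prop :=
  f ∈ Algebra.adjoin ℂ {g : E → ℂ | IsLinearMap ℂ g}

/-- The Zariski topology on a complex vector space, generated by the basic open sets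
`{x | f x ≠ 0}` for `f` a polynomial function; closed sets are the common zero loci
of families of polynomial functions. -/
def zariskiTop (E : Type*) [AddCommGroup E] [Module ℂ E] : TopologicalSpace E :=
  TopologicalSpace.generateFrom {U | ∃ f : E → ℂ, IsPolyFun f ∧ U = {x | f x ≠ 0}}

section Depth

open CategoryTheory Abelian RingTheory.Sequence

universe u

variable {R : Type u} [CommRing R]

/-- `Ext^i(R ⧸ I, M) = 0` for all `i < k`: the `I`-depth of `M` is at least `k`. -/
def DepthGE (I : Ideal R) (k : ℕ) (M : Type u) [AddCommGroup M] [Module R M] : Prop :=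
  ∀ i < k, Subsingleton (Ext (ModuleCat.of R (R ⧸ I)) (ModuleCat.of R M) i)

lemma DepthGE.mono {I : Ideal R} {k l : ℕ} {M : Type u} [AddCommGroup M] [Module R M]
    (h : DepthGE I k M) (hl : l ≤ k) : DepthGE I l M :=
  fun i hi => h i (hi.trans_le hl)

lemma DepthGE.of_exact {I : Ideal R} {k : ℕ} {M₁ M₂ M₃ : Type u} [AddCommGroup M₁]
    [AddCommGroup M₂] [AddCommGroup M₃] [Module R M₁] [Module R M₂] [Module R M₃]
    (f : M₁ →ₗ[R] M₂) (g : M₂ →ₗ[R] M₃) (hf : Function.Injective f)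
    (hg : Function.Surjective g) (hfg : Function.Exact f g)
    (h₁ : DepthGE I (k + 1) M₁) (h₂ : DepthGE I k M₂) : DepthGE I k M₃ := by
  intro i hi
  have hS : (ShortComplex.mk (ModuleCat.ofHom f) (ModuleCat.ofHom g)
      (by ext x; simp [hfg.apply_apply_eq_zero])).ShortExact :=
    { exact := (ShortComplex.ShortExact.moduleCat_exact_iff_function_exact _).mpr hfg
      mono_f := (ModuleCat.mono_iff_injective _).mpr hf
      epi_g := (ModuleCat.epi_iff_surjective _).mpr hg }
  have hs₁ := h₁ (i + 1) (by omega)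
  have hs₂ := h₂ i hi
  refine subsingleton_of_forall_eq 0 fun x => ?_
  obtain ⟨y, rfl⟩ := Ext.covariant_sequence_exact₃ (ModuleCat.of R (R ⧸ I)) hS x rfl
    (hs₁.elim _ _)
  rw [hs₂.elim y 0, Ext.zero_comp]

lemma depthGE_one_iff {I : Ideal R} {M : Type u} [AddCommGroup M] [Module R M] :
    DepthGE I 1 M ↔ ∀ b : M, (∀ r ∈ I, r • b = 0) → b = 0 := by
  have key : DepthGE I 1 M ↔ Subsingleton ((R ⧸ I) →ₗ[R] M) := by
    rw [← (Ext.addEquiv₀.trans ModuleCat.homAddEquiv :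
      Ext (ModuleCat.of R (R ⧸ I)) (ModuleCat.of R M) 0 ≃+ _).toEquiv.subsingleton_congr]
    exact ⟨fun h => h 0 one_pos, fun h i hi => by obtain rfl : i = 0 := by omega
                                                  exact h⟩
  rw [key]
  constructor
  · intro h b hb
    have hle : I ≤ LinearMap.ker (LinearMap.toSpanSingleton R M b) := fun r hr => by
      simpa using hb r hr
    have := LinearMap.congr_fun
      (h.elim (Submodule.liftQ I (LinearMap.toSpanSingleton R M b) hle) 0) (Submodule.Quotient.mk 1)
    rwa [Submodule.liftQ_apply, LinearMap.toSpanSingleton_apply, one_smul] at this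
  · intro h
    refine subsingleton_of_forall_eq 0 fun φ => ?_
    refine Submodule.linearMap_qext _ (LinearMap.ext_ring ?_)
    refine h _ fun r hr => ?_
    rw [← map_smul]
    have : (r • (I.mkQ 1) : R ⧸ I) = 0 := by
      rw [← map_smul]; simpa [Ideal.Quotient.eq_zero_iff_mem] using hr
    simp only [LinearMap.comp_apply]
    rw [map_smul, map_smul, ← map_smul, this, map_zero]

/-- An element killed by an ideal whose radical contains `I` vanishes in positive depth. -/
lemma DepthGE.eq_zero_of_le_radical {I J : Ideal R} (hI : I.FG) {M : Type u} [AddCommGroup M]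
    [Module R M] (h : DepthGE I 1 M) (hJ : I ≤ J.radical) (b : M)
    (hb : ∀ r ∈ J, r • b = 0) : b = 0 := by
  rw [depthGE_one_iff] at h
  obtain ⟨k, hk⟩ := Ideal.exists_pow_le_of_le_radical_of_fg hJ hI
  have : ∀ k, ∀ c : M, (∀ r ∈ I ^ k, r • c = 0) → c = 0 := by
    intro k
    induction k with
    | zero => intro c hc; simpa using hc 1 (by simp)
    | succ k ih =>
      intro c hc
      refine h c fun r hr => ih _ fun s hs => ?_
      rw [smul_smul]
      exact hc _ (by rw [pow_succ]; exact Ideal.mul_mem_mul hs hr)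
  exact this k b fun r hr => hb r (hk hr)

end Depth

section LocalRegularity

open RingTheory.Sequence IsLocalRing

lemma isSMulRegular_quotient_smul_top_iff {R : Type*} [CommRing R] (J : Ideal R) (r : R) :
    IsSMulRegular (R ⧸ (J • ⊤ : Submodule R R)) r ↔ ∀ b, r * b ∈ J → b ∈ J := by
  rw [isSMulRegular_quotient_iff_mem_of_smul_mem]
  simp

lemma mem_ofList_dichotomy {O : Type*} [CommRing O] [IsLocalRing O] (ys : List O) :
    ∀ q ∈ Ideal.ofList ys, q ∈ maximalIdeal O * Ideal.ofList ys ∨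
      ∃ l₁ y l₂ u, ys = l₁ ++ y :: l₂ ∧ IsUnit u ∧ q - u * y ∈ Ideal.ofList (l₁ ++ l₂) := by
  induction ys with
  | nil => intro q hq; left; simpa using hq
  | cons y ys ih =>
    intro q hq
    rw [Ideal.ofList_cons, Submodule.mem_sup] at hq
    obtain ⟨p, hp, q', hq', rfl⟩ := hq
    obtain ⟨r, rfl⟩ := Ideal.mem_span_singleton'.mp hp
    by_cases hr : IsUnit r
    · exact Or.inr ⟨[], y, ys, r, rfl, hr, by simpa using hq'⟩
    rcases ih q' hq' with h | ⟨l₁, z, l₂, u, rfl, hu, h⟩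
    · left
      rw [Ideal.ofList_cons, Ideal.mul_sup]
      exact Submodule.add_mem_sup
        (Ideal.mul_mem_mul hr (Ideal.mem_span_singleton_self y)) h
    · refine Or.inr ⟨y :: l₁, z, l₂, u, rfl, hu, ?_⟩
      rw [List.cons_append, Ideal.ofList_cons, add_sub_assoc]
      exact Submodule.add_mem_sup hp h

lemma ofList_perm {R : Type*} [CommRing R] {l l' : List R} (h : l.Perm l') :
    Ideal.ofList l = Ideal.ofList l' :=
  congrArg Ideal.span (Set.ext fun _ => h.mem_iff)

/-- Exchange lemma: in a regular sequence generating the maximal ideal of a Noetherian local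
ring, one member may be replaced by an element independent of the rest modulo `𝔪²`. -/
lemma exists_exchange {O : Type*} [CommRing O] [IsLocalRing O] [IsNoetherianRing O]
    {hs ys : List O} {h : O} (hreg : IsWeaklyRegular O (hs ++ ys))
    (hgen : Ideal.ofList (hs ++ ys) = maximalIdeal O) (hm : h ∈ maximalIdeal O)
    (hind : h ∉ Ideal.ofList hs ⊔ maximalIdeal O ^ 2) :
    ∃ ys', IsWeaklyRegular O (h :: hs ++ ys') ∧
      Ideal.ofList (h :: hs ++ ys') = maximalIdeal O := by
  have hmem := hm
  rw [← hgen, Ideal.ofList_append, Submodule.mem_sup] at hmem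
  obtain ⟨p, hp, q, hq, rfl⟩ := hmem
  have hys : Ideal.ofList ys ≤ maximalIdeal O := by
    rw [← hgen, Ideal.ofList_append]; exact le_sup_right
  rcases mem_ofList_dichotomy ys q hq with hq' | ⟨l₁, y, l₂, u, rfl, hu, hq'⟩
  · exact (hind (Submodule.add_mem_sup hp (by
      rw [pow_two]; exact Ideal.mul_mono_right hys hq'))).elim
  set l := hs ++ (l₁ ++ l₂) with hl
  have hperm : (hs ++ (l₁ ++ y :: l₂)).Perm (l ++ [y]) := by
    rw [hl, List.append_assoc]
    refine List.Perm.append_left hs (List.perm_middle.trans ?_)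
    exact (List.perm_append_singleton y (l₁ ++ l₂)).symm
  have hperm' : (l ++ [p + q]).Perm ((p + q) :: hs ++ (l₁ ++ l₂)) := by
    rw [hl, List.cons_append]
    exact List.perm_append_singleton _ _
  have hdiff : p + q - u * y ∈ Ideal.ofList l := by
    rw [hl, Ideal.ofList_append, add_sub_assoc]
    exact Submodule.add_mem_sup hp hq'
  clear_value l
  have hgenl : Ideal.ofList (l ++ [y]) = maximalIdeal O := by
    rw [← ofList_perm hperm, hgen]
  have hgen' : Ideal.ofList (l ++ [p + q]) = maximalIdeal O := by
    rw [← hgenl, Ideal.ofList_append l [y], Ideal.ofList_append l [p + q]]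
    simp only [Ideal.ofList_singleton]
    apply le_antisymm
    · refine sup_le le_sup_left ((Ideal.span_singleton_le_iff_mem _).mpr ?_)
      have := Submodule.add_mem_sup hdiff
        (Ideal.mul_mem_left _ u (Ideal.mem_span_singleton_self y))
      simpa using this
    · refine sup_le le_sup_left ((Ideal.span_singleton_le_iff_mem _).mpr ?_)
      have := Submodule.add_mem_sup ((Ideal.ofList l).neg_mem hdiff)
        (Ideal.mem_span_singleton_self (p + q))
      rw [neg_sub, sub_add_cancel] at this
      exact (Ideal.unit_mul_mem_iff_mem _ hu).mp this
  have hregl : IsWeaklyRegular O (l ++ [y]) := by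
    refine isWeaklyRegular_of_perm_of_subset_maximalIdeal hreg hperm fun r hr => ?_
    rw [← hgen]; exact Ideal.subset_span hr
  rw [isWeaklyRegular_append_iff, isWeaklyRegular_singleton_iff,
    isSMulRegular_quotient_smul_top_iff] at hregl
  refine ⟨l₁ ++ l₂, ?_, by rw [← ofList_perm hperm', hgen']⟩
  refine isWeaklyRegular_of_perm_of_subset_maximalIdeal (rs := l ++ [p + q]) ?_ hperm' fun r hr => ?_
  · rw [isWeaklyRegular_append_iff, isWeaklyRegular_singleton_iff,
      isSMulRegular_quotient_smul_top_iff]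
    refine ⟨hregl.1, fun b hb => hregl.2 b ((Ideal.unit_mul_mem_iff_mem _ hu).mp ?_)⟩
    have := (Ideal.ofList l).sub_mem hb (Ideal.mul_mem_right b _ hdiff)
    convert this using 1
    ring
  · rw [← hgen']; exact Ideal.subset_span hr

/-- The coordinates centred at `x`. -/
noncomputable def coords {N : ℕ} (x : Fin N → ℂ) : List (S N) :=
  List.ofFn fun a => X a - C (x a)

lemma isWeaklyRegular_coords {N : ℕ} (x : Fin N → ℂ) : IsWeaklyRegular (S N) (coords x) := by
  refine ⟨fun i hi => ?_⟩
  have hi' : i < N := by simpa [coords] using hi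
  rw [isSMulRegular_quotient_smul_top_iff]
  intro b hb
  set J := Ideal.ofList ((coords x).take i)
  have hJ : ∀ a : Fin N, (a : ℕ) < i → X a - C (x a) ∈ J := by
    intro a ha
    refine Ideal.subset_span (List.mem_iff_getElem.mpr ⟨a, ?_, ?_⟩)
    · simp [coords, ha]
    · simp [coords]
  let φ : S N →ₐ[ℂ] S N := aeval fun a => if (a : ℕ) < i then C (x a) else X a
  have hφJ : J ≤ RingHom.ker φ := by
    refine Ideal.span_le.mpr fun p hp => ?_
    obtain ⟨k, hk, rfl⟩ := List.mem_iff_getElem.mp hp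
    have : k < i ∧ k < N := by simpa [coords] using hk
    simp [coords, φ, this.1, MvPolynomial.algebraMap_eq]
  have hmk : ∀ p, Ideal.Quotient.mk J (φ p) = Ideal.Quotient.mk J p := by
    intro p
    have : (Ideal.Quotient.mkₐ ℂ J).comp φ = Ideal.Quotient.mkₐ ℂ J := by
      refine MvPolynomial.algHom_ext fun a => ?_
      by_cases ha : (a : ℕ) < i
      · simp only [AlgHom.comp_apply, φ, aeval_X, ha, if_true]
        exact (Ideal.Quotient.eq.mpr (hJ a ha)).symm
      · simp [φ, ha]
    exact DFunLike.congr_fun this p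
  have hz : φ ((coords x)[i]) * φ b = 0 := by
    rw [← map_mul]; exact hφJ hb
  have hne : φ ((coords x)[i]) ≠ 0 := by
    have h1 : φ ((coords x)[i]) = X ⟨i, hi'⟩ - C (x ⟨i, hi'⟩) := by
      simp [coords, φ, MvPolynomial.algebraMap_eq]
    rw [h1]
    intro h0
    have := congrArg (eval fun _ => x ⟨i, hi'⟩ + 1) h0
    simp at this
  have hb0 : φ b = 0 := (mul_eq_zero.mp hz).resolve_left hne
  rw [← Ideal.Quotient.eq_zero_iff_mem, ← hmk, hb0, map_zero]

lemma ofList_coords {N : ℕ} (x : Fin N → ℂ) :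
    Ideal.ofList (coords x) = RingHom.ker (eval x) := by
  have hJ : ∀ a : Fin N, X a - C (x a) ∈ Ideal.ofList (coords x) := fun a =>
    Ideal.subset_span (by simp [coords, List.mem_ofFn])
  apply le_antisymm
  · refine Ideal.span_le.mpr fun p hp => ?_
    obtain ⟨a, rfl⟩ : ∃ a, X a - C (x a) = p := by simpa [coords, List.mem_ofFn] using hp
    simp
  · intro p hp
    have : (Ideal.Quotient.mk (Ideal.ofList (coords x))) =
        (Ideal.Quotient.mk (Ideal.ofList (coords x))).comp (C.comp (eval x)) := by
      refine MvPolynomial.ringHom_ext (by simp) fun a => ?_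
      simpa using Ideal.Quotient.eq.mpr (hJ a)
    rw [← Ideal.Quotient.eq_zero_iff_mem, this]
    simp [RingHom.mem_ker.mp hp]

/-- The differential at the point `x`. -/
noncomputable def dAt {N : ℕ} (x : Fin N → ℂ) (p : S N) : Fin N → ℂ := fun k => eval x (pderiv k p)

lemma dAt_add {N : ℕ} (x : Fin N → ℂ) (p q : S N) : dAt x (p + q) = dAt x p + dAt x q := by
  ext k; simp [dAt]

lemma dAt_mul {N : ℕ} (x : Fin N → ℂ) (p q : S N) :
    dAt x (p * q) = eval x p • dAt x q + eval x q • dAt x p := by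
  ext k; simp [dAt, Derivation.leibniz]

/-- The ideal generated by the `F i`, `i ∈ T`. -/
noncomputable def idealOf {N : ℕ} {ι : Type*} (F : ι → S N) (T : Finset ι) : Ideal (S N) :=
  Ideal.span (F '' T)

lemma mem_idealOf {N : ℕ} {ι : Type*} {F : ι → S N} {T : Finset ι} {i : ι} (hi : i ∈ T) :
    F i ∈ idealOf F T := Ideal.subset_span ⟨i, hi, rfl⟩

lemma dAt_mem_span {N : ℕ} {ι : Type*} {F : ι → S N} {T : Finset ι} {x : Fin N → ℂ}
    (hT : ∀ i ∈ T, eval x (F i) = 0) {p : S N}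
    (hp : p ∈ idealOf F T ⊔ RingHom.ker (eval x) ^ 2) :
    dAt x p ∈ Submodule.span ℂ ((fun i => dAt x (F i)) '' T) := by
  obtain ⟨q, hq, r, hr, rfl⟩ := Submodule.mem_sup.mp hp
  rw [dAt_add]
  refine Submodule.add_mem _ ?_ ?_
  · refine Submodule.span_induction (p := fun q _ => eval x q = 0 ∧
      dAt x q ∈ Submodule.span ℂ ((fun i => dAt x (F i)) '' T)) ?_ ?_ ?_ ?_ hq |>.2
    · rintro _ ⟨i, hi, rfl⟩
      exact ⟨hT i hi, Submodule.subset_span ⟨i, hi, rfl⟩⟩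
    · refine ⟨map_zero _, ?_⟩
      rw [show dAt x (0 : S N) = 0 by ext k; simp [dAt]]
      exact zero_mem _
    · rintro a b - - ⟨ha, ha'⟩ ⟨hb, hb'⟩
      rw [dAt_add]
      exact ⟨by simp [ha, hb], add_mem ha' hb'⟩
    · rintro a b - ⟨hb, hb'⟩
      rw [smul_eq_mul, dAt_mul, hb, zero_smul, add_zero]
      exact ⟨by simp [hb], Submodule.smul_mem _ _ hb'⟩
  · have : dAt x r = 0 := by
      rw [pow_two] at hr
      refine Submodule.mul_induction_on hr ?_ ?_
      · intro a ha b hb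
        rw [dAt_mul, RingHom.mem_ker.mp ha, RingHom.mem_ker.mp hb, zero_smul, zero_smul, add_zero]
      · intro a b ha hb; rw [dAt_add, ha, hb, add_zero]
    rw [this]; exact zero_mem _

lemma ofList_map_toList {N : ℕ} {ι : Type*} {O : Type*} [CommRing O] [Algebra (S N) O]
    (F : ι → S N) (T : Finset ι) :
    Ideal.ofList (T.toList.map fun i => algebraMap (S N) O (F i)) =
      (idealOf F T).map (algebraMap (S N) O) := by
  rw [idealOf, Ideal.map_span, Ideal.ofList]
  congr 1
  ext z
  simp

instance {N : ℕ} (x : Fin N → ℂ) : (RingHom.ker (eval x)).IsPrime := RingHom.ker_isPrime _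

lemma exists_isWeaklyRegular_localization {N : ℕ} {ι : Type*} (F : ι → S N) (x : Fin N → ℂ)
    (hind : LinearIndependent ℂ (fun i : {i : ι // eval x (F i) = 0} => dAt x (F i.1)))
    (T : Finset ι) (hT : ∀ i ∈ T, eval x (F i) = 0) :
    ∃ ys : List (Localization.AtPrime (RingHom.ker (eval x))),
      IsWeaklyRegular (Localization.AtPrime (RingHom.ker (eval x)))
        (T.toList.map (fun i => algebraMap (S N) _ (F i)) ++ ys) ∧
      Ideal.ofList (T.toList.map (fun i => algebraMap (S N) _ (F i)) ++ ys) =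
        maximalIdeal (Localization.AtPrime (RingHom.ker (eval x))) := by
  classical
  let P := RingHom.ker (eval x)
  induction T using Finset.induction_on with
  | empty =>
    refine ⟨(coords x).map (algebraMap (S N) _), ?_, ?_⟩
    · simpa using (isWeaklyRegular_coords x).of_isLocalization (Localization.AtPrime P) P.primeCompl
    · simp only [Finset.toList_empty, List.map_nil, List.nil_append]
      rw [← Ideal.map_ofList, ofList_coords, Localization.AtPrime.map_eq_maximalIdeal]
  | insert j T hj ih =>
    obtain ⟨ys, hreg, hgen⟩ := ih fun i hi => hT i (Finset.mem_insert_of_mem hi)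
    have hjx : eval x (F j) = 0 := hT j (Finset.mem_insert_self _ _)
    obtain ⟨ys', hreg', hgen'⟩ := exists_exchange (h := algebraMap (S N) _ (F j)) hreg hgen
      ((IsLocalization.AtPrime.to_map_mem_maximal_iff _ P (F j)).mpr hjx) (by
        intro hmem
        rw [ofList_map_toList, ← Localization.AtPrime.map_eq_maximalIdeal, ← Ideal.map_pow,
          ← Ideal.map_sup, IsLocalization.algebraMap_mem_map_algebraMap_iff P.primeCompl] at hmem
        obtain ⟨s, hs, hsF⟩ := hmem
        have hs' : eval x s ≠ 0 := hs
        have h1 := dAt_mem_span (fun i hi => hT i (Finset.mem_insert_of_mem hi)) hsF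
        rw [dAt_mul, hjx, zero_smul, add_zero] at h1
        have h2 := (Submodule.smul_mem_iff _ hs').mp h1
        refine hind.notMem_span_image (s := {i | i.1 ∈ T}) (x := ⟨j, hjx⟩) (by simpa using hj) ?_
        convert h2 using 2
        ext v
        constructor
        · rintro ⟨i, hi, rfl⟩; exact ⟨i.1, hi, rfl⟩
        · rintro ⟨i, hi, rfl⟩
          exact ⟨⟨i, hT i (Finset.mem_insert_of_mem hi)⟩, hi, rfl⟩)
    have hperm : ((algebraMap (S N) (Localization.AtPrime P) (F j)) ::
        T.toList.map (fun i => algebraMap (S N) (Localization.AtPrime P) (F i)) ++ ys').Perm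
        ((insert j T).toList.map (fun i => algebraMap (S N) (Localization.AtPrime P) (F i)) ++ ys') :=
      List.Perm.append_right _ ((Finset.toList_insert hj).map
        (fun i => algebraMap (S N) (Localization.AtPrime P) (F i))).symm
    refine ⟨ys', ?_, by rw [← ofList_perm hperm, hgen']⟩
    refine isWeaklyRegular_of_perm_of_subset_maximalIdeal hreg' hperm fun r hr => ?_
    rw [← hgen']; exact Ideal.subset_span hr

/-- Local regularity at a nonzero point. -/
lemma exists_mul_mem_idealOf {N : ℕ} {ι : Type*} (F : ι → S N) (x : Fin N → ℂ)
    (hind : LinearIndependent ℂ (fun i : {i : ι // eval x (F i) = 0} => dAt x (F i.1)))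
    {T : Finset ι} {j : ι} (hj : j ∉ T) {b : S N} (hb : F j * b ∈ idealOf F T) :
    ∃ s, eval x s ≠ 0 ∧ s * b ∈ idealOf F T := by
  classical
  by_cases hall : ∀ i ∈ insert j T, eval x (F i) = 0
  swap
  · push Not at hall
    obtain ⟨i, hi, hix⟩ := hall
    rcases Finset.mem_insert.mp hi with rfl | hi
    · exact ⟨F i, hix, hb⟩
    · exact ⟨F i, hix, Ideal.mul_mem_right _ _ (mem_idealOf hi)⟩
  let P := RingHom.ker (eval x)
  let O := Localization.AtPrime P
  obtain ⟨ys, hreg, hgen⟩ := exists_isWeaklyRegular_localization F x hind _ hall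
  have hperm : ((insert j T).toList.map (fun i => algebraMap (S N) O (F i)) ++ ys).Perm
      ((T.toList.map (fun i => algebraMap (S N) O (F i)) ++ [algebraMap (S N) O (F j)]) ++ ys) :=
    List.Perm.append_right _ (((Finset.toList_insert hj).map _).trans
      (List.perm_append_singleton _ _).symm)
  have h1 : IsWeaklyRegular O _ := isWeaklyRegular_of_perm_of_subset_maximalIdeal hreg hperm
    fun r hr => by rw [← hgen]; exact Ideal.subset_span hr
  rw [isWeaklyRegular_append_iff, isWeaklyRegular_append_iff, isWeaklyRegular_singleton_iff,
    isSMulRegular_quotient_smul_top_iff, ofList_map_toList] at h1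
  have h2 := h1.1.2 (algebraMap (S N) O b) (by
    rw [← map_mul]; exact Ideal.mem_map_of_mem _ hb)
  rw [IsLocalization.algebraMap_mem_map_algebraMap_iff P.primeCompl] at h2
  obtain ⟨s, hs, hsb⟩ := h2
  exact ⟨s, hs, hsb⟩

end LocalRegularity

section GlobalRegularity

open RingTheory.Sequence

/-- The irrelevant maximal ideal. -/
noncomputable abbrev irr (N : ℕ) : Ideal (S N) := RingHom.ker (eval (0 : Fin N → ℂ))

/-- An element of a module of positive depth that is locally killed away from the origin
vanishes. -/
lemma DepthGE.eq_zero_of_forall_point {N : ℕ} {M : Type} [AddCommGroup M] [Module (S N) M]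
    (h : DepthGE (irr N) 1 M) (b : M)
    (hb : ∀ x : Fin N → ℂ, x ≠ 0 → ∃ s : S N, eval x s ≠ 0 ∧ s • b = 0) : b = 0 := by
  refine h.eq_zero_of_le_radical (J := LinearMap.ker (LinearMap.toSpanSingleton (S N) M b))
    (IsNoetherian.noetherian _) ?_ b fun r hr => by simpa using hr
  rw [← MvPolynomial.vanishingIdeal_zeroLocus_eq_radical (K := ℂ)]
  intro p hp
  rw [mem_vanishingIdeal_iff]
  intro x hx
  by_cases hx0 : x = 0
  · subst hx0; exact hp
  · obtain ⟨s, hs, hsb⟩ := hb x hx0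
    exact (hs (hx s (by simpa using hsb))).elim

lemma depthGE_self (N : ℕ) : DepthGE (irr N) N (S N) := by
  have hlt : (irr N) • (⊤ : Submodule (S N) (S N)) < ⊤ := by
    rw [smul_eq_mul, Ideal.mul_top]
    exact lt_top_iff_ne_top.mpr (inferInstance : (irr N).IsPrime).ne_top
  have := ModuleCat.subsingleton_ext_of_exists_isRegular (irr N)
    (ModuleCat.of (S N) (S N ⧸ irr N)) (by
      rw [Module.support_eq_zeroLocus, Ideal.annihilator_quotient])
    (ModuleCat.of (S N) (S N)) hlt (coords 0)
    (fun r hr => by rw [irr, ← ofList_coords]; exact Ideal.subset_span hr)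
    ⟨isWeaklyRegular_coords 0, by
      change ⊤ ≠ Ideal.ofList (coords 0) • (⊤ : Submodule (S N) (S N))
      rw [ofList_coords]; exact hlt.ne'⟩
  simpa [DepthGE, coords] using this

/-- The differentials of those `F i` that vanish at a nonzero point are independent there. -/
def Transverse {N : ℕ} {ι : Type*} (F : ι → S N) : Prop :=
  ∀ x : Fin N → ℂ, x ≠ 0 →
    LinearIndependent ℂ (fun i : {i : ι // eval x (F i) = 0} => dAt x (F i.1))

lemma DepthGE.mem_of_forall_point {N : ℕ} {I : Ideal (S N)} (h : DepthGE (irr N) 1 (S N ⧸ I))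
    {b : S N} (hb : ∀ x : Fin N → ℂ, x ≠ 0 → ∃ s : S N, eval x s ≠ 0 ∧ s * b ∈ I) : b ∈ I := by
  rw [← Ideal.Quotient.eq_zero_iff_mem]
  refine h.eq_zero_of_forall_point _ fun x hx => ?_
  obtain ⟨s, hs, hsb⟩ := hb x hx
  refine ⟨s, hs, ?_⟩
  rw [← Ideal.Quotient.eq_zero_iff_mem, map_mul] at hsb
  exact hsb

variable {N : ℕ} {ι : Type*} {F : ι → S N}

lemma mem_idealOf_of_mul_mem_of_depthGE (hF : Transverse F) {T : Finset ι}
    (hT : DepthGE (irr N) 1 (S N ⧸ idealOf F T)) {j : ι} (hj : j ∉ T) {b : S N}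
    (hb : F j * b ∈ idealOf F T) : b ∈ idealOf F T :=
  hT.mem_of_forall_point fun x hx => exists_mul_mem_idealOf F x (hF x hx) hj hb

lemma idealOf_insert [DecidableEq ι] (j : ι) (T : Finset ι) :
    idealOf F (insert j T) = Ideal.span {F j} ⊔ idealOf F T := by
  rw [idealOf, Finset.coe_insert, Set.image_insert_eq, Ideal.span_insert, idealOf]

lemma depthGE_quotient_idealOf (hF : Transverse F) (T : Finset ι) :
    T.card ≤ N → DepthGE (irr N) (N - T.card) (S N ⧸ idealOf F T) := by
  classical
  induction T using Finset.induction_on with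
  | empty =>
    intro _
    have h : idealOf F (∅ : Finset ι) = ⊥ := by simp [idealOf]
    rw [h, Finset.card_empty, Nat.sub_zero]
    have e := Submodule.quotEquivOfEqBot (⊥ : Ideal (S N)) rfl
    refine DepthGE.of_exact (0 : PUnit →ₗ[S N] S N) e.symm.toLinearMap ?_ e.symm.surjective ?_
      ?_ (depthGE_self N)
    · exact fun _ _ _ => rfl
    · intro y
      rw [LinearEquiv.coe_coe, LinearEquiv.map_eq_zero_iff]
      simp [eq_comm]
    · intro i _
      have hz : CategoryTheory.Limits.IsZero (ModuleCat.of (S N) PUnit.{1}) :=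
        ModuleCat.isZero_of_subsingleton _
      refine subsingleton_of_forall_eq 0 fun y => ?_
      rw [← CategoryTheory.Abelian.Ext.comp_mk₀_id y, hz.eq_of_src (CategoryTheory.CategoryStruct.id _) 0,
        CategoryTheory.Abelian.Ext.mk₀_zero, CategoryTheory.Abelian.Ext.comp_zero]
  | insert j T hj ih =>
    intro hcard
    rw [Finset.card_insert_of_notMem hj] at hcard ⊢
    have hT := ih (by omega)
    have hle : idealOf F T ≤ idealOf F (insert j T) := by
      rw [idealOf_insert]; exact le_sup_right
    refine DepthGE.of_exact (LinearMap.lsmul (S N) (S N ⧸ idealOf F T) (F j))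
      (Submodule.mapQ (idealOf F T) (idealOf F (insert j T)) LinearMap.id hle) ?_ ?_ ?_
      (hT.mono (by omega)) (hT.mono (by omega))
    · rw [injective_iff_map_eq_zero]
      intro b hb
      obtain ⟨b, rfl⟩ := Ideal.Quotient.mk_surjective b
      rw [Ideal.Quotient.eq_zero_iff_mem]
      refine mem_idealOf_of_mul_mem_of_depthGE hF (hT.mono (by omega)) hj ?_
      rw [← Ideal.Quotient.eq_zero_iff_mem, map_mul]
      exact hb
    · intro y
      obtain ⟨y, rfl⟩ := Ideal.Quotient.mk_surjective y
      exact ⟨Ideal.Quotient.mk _ y, rfl⟩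
    · intro y
      obtain ⟨y, rfl⟩ := Ideal.Quotient.mk_surjective y
      constructor
      · intro h
        have h' : y ∈ idealOf F (insert j T) := Ideal.Quotient.eq_zero_iff_mem.mp h
        rw [idealOf_insert, Submodule.mem_sup] at h'
        obtain ⟨p, hp, q, hq, rfl⟩ := h'
        obtain ⟨r, rfl⟩ := Ideal.mem_span_singleton'.mp hp
        refine ⟨Ideal.Quotient.mk _ r, ?_⟩
        rw [map_add, Ideal.Quotient.eq_zero_iff_mem.mpr hq, add_zero, mul_comm, map_mul]
        rfl
      · rintro ⟨r, hr⟩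
        obtain ⟨r, rfl⟩ := Ideal.Quotient.mk_surjective r
        rw [← hr]
        have : Ideal.Quotient.mk (idealOf F (insert j T)) (F j * r) = 0 :=
          Ideal.Quotient.eq_zero_iff_mem.mpr
            (Ideal.mul_mem_right _ _ (mem_idealOf (Finset.mem_insert_self _ _)))
        exact this

lemma mem_idealOf_of_mul_mem (hF : Transverse F) {T : Finset ι} (hT : T.card < N) {j : ι}
    (hj : j ∉ T) {b : S N} (hb : F j * b ∈ idealOf F T) : b ∈ idealOf F T :=
  mem_idealOf_of_mul_mem_of_depthGE hF
    ((depthGE_quotient_idealOf hF T hT.le).mono (by omega)) hj hb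

lemma mem_idealOf_of_prod_mul_mem (hF : Transverse F) {T : Finset ι} (hT : T.card < N)
    (U : Finset ι) (hU : Disjoint U T) {b : S N} (hb : (∏ j ∈ U, F j) * b ∈ idealOf F T) :
    b ∈ idealOf F T := by
  classical
  induction U using Finset.induction_on with
  | empty => simpa using hb
  | insert j U hj ih =>
    rw [Finset.disjoint_insert_left] at hU
    rw [Finset.prod_insert hj, mul_assoc] at hb
    exact ih hU.2 (mem_idealOf_of_mul_mem hF hT hU.1 hb)

end GlobalRegularity

section Division

lemma exists_minor_ne_zero {N : ℕ} {u v : Fin N → ℂ} (h : LinearIndependent ℂ ![u, v]) :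
    ∃ a b, u a * v b - u b * v a ≠ 0 := by
  by_contra! hz
  rw [LinearIndependent.pair_iff] at h
  have hv : ∀ b, v b = 0 := fun b => (h (v b) (-u b) (by
    ext a; simpa [sub_eq_add_neg, mul_comm] using hz a b)).1
  exact one_ne_zero (h 0 1 (by ext a; simp [hv])).2

lemma exists_three_minor_ne_zero {N : ℕ} {u v w : Fin N → ℂ}
    (h : LinearIndependent ℂ ![u, v, w]) :
    ∃ a b c, u a * (v b * w c - v c * w b) - u b * (v a * w c - v c * w a) +
      u c * (v a * w b - v b * w a) ≠ 0 := by
  have hvw : LinearIndependent ℂ ![v, w] := by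
    have := h.comp ![1, 2] (by decide)
    convert this using 1
    ext i k
    fin_cases i <;> rfl
  obtain ⟨b, c, hbc⟩ := exists_minor_ne_zero hvw
  by_contra! hz
  rw [Fintype.linearIndependent_iff] at h
  have := h ![v b * w c - v c * w b, -(u b * w c - u c * w b), u b * v c - u c * v b] (by
    ext a
    simp only [Fin.sum_univ_three, Matrix.cons_val, Pi.add_apply, Pi.smul_apply, smul_eq_mul,
      Pi.zero_apply]
    rw [← hz a b c]
    ring) 0
  exact hbc this

variable {N : ℕ} {ι : Type*} {F : ι → S N}

lemma idealOf_mono {T U : Finset ι} (h : T ⊆ U) : idealOf F T ≤ idealOf F U :=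
  Ideal.span_mono (Set.image_mono (by exact_mod_cast h))

variable [DecidableEq ι]

lemma mem_idealOf_insert {j : ι} {T : Finset ι} {p : S N} :
    p ∈ idealOf F (insert j T) ↔ ∃ q, p - q * F j ∈ idealOf F T := by
  rw [idealOf_insert, Submodule.mem_sup]
  constructor
  · rintro ⟨_, hr, s, hs, rfl⟩
    obtain ⟨q, rfl⟩ := Ideal.mem_span_singleton'.mp hr
    exact ⟨q, by simpa using hs⟩
  · rintro ⟨q, hq⟩
    exact ⟨_, Ideal.mul_mem_left _ q (Ideal.mem_span_singleton_self _), _, hq, by ring⟩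

lemma mem_idealOf_pair {i j : ι} {p : S N} :
    p ∈ idealOf F {i, j} ↔ ∃ q r, p = q * F i + r * F j := by
  rw [idealOf, Finset.coe_pair, Set.image_pair, Ideal.mem_span_pair]
  simp only [eq_comm]

lemma Transverse.exists_minor (hF : Transverse F) {i j : ι} (hij : i ≠ j) {x : Fin N → ℂ}
    (hx : x ≠ 0) : ∃ s, eval x s ≠ 0 ∧
      (s ∈ idealOf F {i, j} ∨ ∃ a b, s = w11 (Dp (F i)) (Dp (F j)) a b) := by
  by_cases hi : eval x (F i) = 0
  swap
  · exact ⟨F i, hi, Or.inl (mem_idealOf (by simp))⟩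
  by_cases hj : eval x (F j) = 0
  swap
  · exact ⟨F j, hj, Or.inl (mem_idealOf (by simp))⟩
  have h : LinearIndependent ℂ ![dAt x (F i), dAt x (F j)] := by
    have := (hF x hx).comp ![⟨i, hi⟩, ⟨j, hj⟩] (by
      intro a b hab; fin_cases a <;> fin_cases b <;> simp_all)
    convert this using 1
    ext a k
    fin_cases a <;> rfl
  obtain ⟨a, b, hab⟩ := exists_minor_ne_zero h
  exact ⟨_, by simpa [w11, Dp, dAt] using hab, Or.inr ⟨a, b, rfl⟩⟩

lemma Transverse.exists_three_minor (hF : Transverse F) {i j r : ι} (hij : i ≠ j) (hri : r ≠ i)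
    (hrj : r ≠ j) {x : Fin N → ℂ} (hx : x ≠ 0) : ∃ s, eval x s ≠ 0 ∧
      (s ∈ idealOf F {r, i, j} ∨
        ∃ a b c, s = w12 (Dp (F r)) (w11 (Dp (F i)) (Dp (F j))) a b c) := by
  by_cases hr : eval x (F r) = 0
  swap
  · exact ⟨F r, hr, Or.inl (mem_idealOf (by simp))⟩
  by_cases hi : eval x (F i) = 0
  swap
  · exact ⟨F i, hi, Or.inl (mem_idealOf (by simp))⟩
  by_cases hj : eval x (F j) = 0
  swap
  · exact ⟨F j, hj, Or.inl (mem_idealOf (by simp))⟩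
  have h : LinearIndependent ℂ ![dAt x (F r), dAt x (F i), dAt x (F j)] := by
    have := (hF x hx).comp ![⟨r, hr⟩, ⟨i, hi⟩, ⟨j, hj⟩] (by
      intro a b hab; fin_cases a <;> fin_cases b <;> simp_all)
    convert this using 1
    ext a k
    fin_cases a <;> rfl
  obtain ⟨a, b, c, habc⟩ := exists_three_minor_ne_zero h
  exact ⟨_, by simpa [w12, w11, Dp, dAt] using habc, Or.inr ⟨a, b, c, rfl⟩⟩

/-- Multiplication of a 1-form by functions, on coefficients in `M`. -/
noncomputable def formMul (M : Type) [AddCommGroup M] [Module (S N) M] (v : Form1 N) :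
    M →ₗ[S N] (Fin N → M) :=
  LinearMap.pi fun k => LinearMap.lsmul (S N) M (v k)

lemma DepthGE.pi {M : Type} [AddCommGroup M] [Module (S N) M] (h : DepthGE (irr N) 1 M) :
    DepthGE (irr N) 1 (Fin N → M) := by
  rw [depthGE_one_iff] at h ⊢
  exact fun b hb => funext fun k => h _ fun r hr => congrFun (hb r hr) k

/-- De Rham division: a 1-form annihilated by `∧ dFᵢ ∧ dFⱼ` modulo `(Fᵢ, Fⱼ)` is a combination
of `dFᵢ` and `dFⱼ` modulo `(Fᵢ, Fⱼ)`. -/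
lemma Transverse.exists_division (hF : Transverse F) (hN : 4 ≤ N) {i j : ι} (hij : i ≠ j)
    {γ : Form1 N}
    (h : ∀ a b c, w12 γ (w11 (Dp (F i)) (Dp (F j))) a b c ∈ idealOf F {i, j}) :
    ∃ p q, ∀ k, γ k - p * pderiv k (F i) - q * pderiv k (F j) ∈ idealOf F {i, j} := by
  let I := idealOf F {i, j}
  let B := S N ⧸ I
  have hI : ∀ s ∈ I, ∀ b : B, s • b = 0 := by
    intro s hs b
    obtain ⟨b, rfl⟩ := Ideal.Quotient.mk_surjective b
    exact Ideal.Quotient.eq_zero_iff_mem.mpr (Ideal.mul_mem_right b _ hs)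
  have hB : DepthGE (irr N) 2 B :=
    (depthGE_quotient_idealOf hF {i, j} (by rw [Finset.card_pair hij]; omega)).mono
      (by rw [Finset.card_pair hij]; omega)
  let φ := formMul B (Dp (F i))
  have hφ : Function.Injective φ := by
    rw [injective_iff_map_eq_zero]
    intro b hb
    have hb' : ∀ k, Dp (F i) k • b = 0 := fun k => congrFun hb k
    refine (hB.mono one_le_two).eq_zero_of_forall_point b fun x hx => ?_
    obtain ⟨s, hs, hsI | ⟨a, c, rfl⟩⟩ := hF.exists_minor hij hx
    · exact ⟨s, hs, hI s hsI b⟩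
    · refine ⟨_, hs, ?_⟩
      rw [w11, sub_smul, mul_comm, mul_smul, hb', mul_comm (Dp (F i) c), mul_smul, hb']
      simp
  have hQ₁ : DepthGE (irr N) 1 ((Fin N → B) ⧸ LinearMap.range φ) :=
    DepthGE.of_exact φ (LinearMap.range φ).mkQ hφ (Submodule.mkQ_surjective _)
      (LinearMap.exact_map_mkQ_range φ) hB (hB.mono one_le_two).pi
  let ψ := (LinearMap.range φ).mkQ ∘ₗ formMul B (Dp (F j))
  have hψ : Function.Injective ψ := by
    rw [injective_iff_map_eq_zero]
    intro b hb
    obtain ⟨c, hc⟩ := (Submodule.Quotient.mk_eq_zero _).mp hb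
    have hc' : ∀ k, Dp (F i) k • c = Dp (F j) k • b := fun k => congrFun hc k
    refine (hB.mono one_le_two).eq_zero_of_forall_point b fun x hx => ?_
    obtain ⟨s, hs, hsI | ⟨k, l, rfl⟩⟩ := hF.exists_minor hij hx
    · exact ⟨s, hs, hI s hsI b⟩
    · refine ⟨_, hs, ?_⟩
      rw [w11, sub_smul, mul_smul, ← hc', mul_smul, ← hc', smul_smul, smul_smul, mul_comm, sub_self]
  have hQ : DepthGE (irr N) 1 (((Fin N → B) ⧸ LinearMap.range φ) ⧸ LinearMap.range ψ) :=
    DepthGE.of_exact ψ (LinearMap.range ψ).mkQ hψ (Submodule.mkQ_surjective _)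
      (LinearMap.exact_map_mkQ_range ψ) hB hQ₁
  let g : Fin N → B := fun k => Ideal.Quotient.mk I (γ k)
  have hz : (LinearMap.range ψ).mkQ ((LinearMap.range φ).mkQ g) = 0 := by
    refine hQ.eq_zero_of_forall_point _ fun x hx => ?_
    obtain ⟨s, hs, hsI | ⟨b, c, rfl⟩⟩ := hF.exists_minor hij hx
    · refine ⟨s, hs, ?_⟩
      rw [← map_smul, ← map_smul, show s • g = 0 from funext fun k => hI s hsI _, map_zero, map_zero]
    · refine ⟨_, hs, ?_⟩
      have key : w11 (Dp (F i)) (Dp (F j)) b c • g =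
          φ (Ideal.Quotient.mk I (γ b * Dp (F j) c - γ c * Dp (F j) b)) +
          formMul B (Dp (F j)) (Ideal.Quotient.mk I (γ c * Dp (F i) b - γ b * Dp (F i) c)) := by
        funext a
        change Ideal.Quotient.mk I (w11 (Dp (F i)) (Dp (F j)) b c * γ a) =
          Ideal.Quotient.mk I (Dp (F i) a * (γ b * Dp (F j) c - γ c * Dp (F j) b) +
            Dp (F j) a * (γ c * Dp (F i) b - γ b * Dp (F i) c))
        rw [Ideal.Quotient.eq]
        convert h a b c using 1
        simp only [w12, w11]
        ring
      rw [← map_smul, ← map_smul, key, map_add, map_add,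
        Submodule.mkQ_apply (LinearMap.range φ) (φ _),
        (Submodule.Quotient.mk_eq_zero _).mpr (LinearMap.mem_range_self φ _), map_zero, zero_add]
      exact (Submodule.Quotient.mk_eq_zero _).mpr (LinearMap.mem_range_self ψ _)
  obtain ⟨q, hq⟩ := (Submodule.Quotient.mk_eq_zero _).mp hz
  obtain ⟨p, hp⟩ := (Submodule.Quotient.eq _).mp hq
  obtain ⟨q, rfl⟩ := Ideal.Quotient.mk_surjective q
  obtain ⟨p, rfl⟩ := Ideal.Quotient.mk_surjective p
  refine ⟨-p, q, fun k => ?_⟩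
  have hk : Ideal.Quotient.mk I (pderiv k (F i) * p) =
      Ideal.Quotient.mk I (pderiv k (F j) * q - γ k) := congrFun hp k
  rw [Ideal.Quotient.eq] at hk
  convert hk using 1
  ring

lemma Transverse.mem_of_three_minors (hF : Transverse F) (hN : 4 ≤ N) {i j r : ι} (hij : i ≠ j)
    (hri : r ≠ i) (hrj : r ≠ j) {q : S N}
    (h : ∀ a b c, w12 (Dp (F r)) (w11 (Dp (F i)) (Dp (F j))) a b c * q ∈ idealOf F {r, i, j}) :
    q ∈ idealOf F {r, i, j} := by
  have hcard : #{r, i, j} = 3 := Finset.card_eq_three.mpr ⟨r, i, j, hri, hrj, hij, rfl⟩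
  refine ((depthGE_quotient_idealOf hF {r, i, j} (by omega)).mono
    (by omega)).mem_of_forall_point fun x hx => ?_
  obtain ⟨s, hs, hsI | ⟨a, b, c, rfl⟩⟩ := hF.exists_three_minor hij hri hrj hx
  · exact ⟨s, hs, Ideal.mul_mem_right _ _ hsI⟩
  · exact ⟨_, hs, h a b c⟩

lemma Transverse.exists_sub_mul_prod_mem (hF : Transverse F) {T : Finset ι} (hT : #T + 1 < N)
    {q : S N} (U : Finset ι) (hU : Disjoint U T) (h : ∀ r ∈ U, q ∈ idealOf F (insert r T)) :
    ∃ q', q - q' * ∏ r ∈ U, F r ∈ idealOf F T := by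
  induction U using Finset.induction_on with
  | empty => exact ⟨q, by simp⟩
  | insert s U hs ih =>
    rw [Finset.disjoint_insert_left] at hU
    obtain ⟨q₁, hq₁⟩ := ih hU.2 fun r hr => h r (Finset.mem_insert_of_mem hr)
    have h₁ : (∏ r ∈ U, F r) * q₁ ∈ idealOf F (insert s T) := by
      have := Ideal.sub_mem _ (h s (Finset.mem_insert_self _ _))
        (idealOf_mono (Finset.subset_insert s T) hq₁)
      convert this using 1
      ring
    have h₂ := mem_idealOf_of_prod_mul_mem hF (by rw [Finset.card_insert_of_notMem hU.1]; omega) U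
      (Finset.disjoint_insert_right.mpr ⟨hs, hU.2⟩) h₁
    obtain ⟨q₂, hq₂⟩ := mem_idealOf_insert.mp h₂
    refine ⟨q₂, ?_⟩
    rw [Finset.prod_insert hs]
    convert Ideal.add_mem _ hq₁ (Ideal.mul_mem_right (∏ r ∈ U, F r) _ hq₂) using 1
    ring

end Division

section Structure

variable {N : ℕ}

lemma mem_pow_idealOfVars_of_isHomogeneous {p : S N} {k : ℕ} (hp : p.IsHomogeneous k) :
    p ∈ idealOfVars (Fin N) ℂ ^ k := by
  rw [mem_pow_idealOfVars_iff]
  intro x hx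
  exact (hp.degree_eq_sum_deg_support hx).le

variable {ι : Type*} [DecidableEq ι] {F : ι → S N} {dd : ι → ℕ}

lemma w12_mem {I : Ideal (S N)} {e : Form1 N} (he : ∀ k, e k ∈ I) (β : Fin N → Fin N → S N)
    (a b c : Fin N) : w12 e β a b c ∈ I :=
  I.add_mem (I.sub_mem (I.mul_mem_right _ (he a)) (I.mul_mem_right _ (he b)))
    (I.mul_mem_right _ (he c))

/-- A 1-form annihilated by `∧ dFᵢ ∧ dFⱼ` modulo `(Fᵢ, Fⱼ)` for all `j ∈ J` is a multiple of `dFᵢ`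
modulo `Fᵢ` and a power of the irrelevant ideal. -/
lemma Transverse.exists_sub_mul_pderiv_mem (hF : Transverse F) (hN : 4 ≤ N)
    (hFh : ∀ j, (F j).IsHomogeneous (dd j)) {i : ι} (J : Finset ι) (hi : i ∉ J) (γ : Form1 N)
    (h : ∀ j ∈ J, ∀ a b c, w12 γ (w11 (Dp (F i)) (Dp (F j))) a b c ∈ idealOf F {i, j}) :
    ∃ p, ∀ k, γ k - p * pderiv k (F i) ∈
      Ideal.span {F i} ⊔ idealOfVars (Fin N) ℂ ^ (∑ j ∈ J, dd j - 1) := by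
  induction J using Finset.induction_on generalizing γ with
  | empty => exact ⟨0, by simp⟩
  | insert j J hj ih =>
    obtain ⟨hij, hiJ⟩ : i ≠ j ∧ i ∉ J := by simpa using hi
    obtain ⟨p, q, hpq⟩ := hF.exists_division hN hij (h j (Finset.mem_insert_self _ _))
    obtain ⟨q', hq'⟩ := hF.exists_sub_mul_prod_mem (T := {i, j}) (q := q)
      (by rw [Finset.card_pair hij]; omega) J
      (by simp [Finset.disjoint_insert_right, hiJ, hj]) fun r hr => by
        refine hF.mem_of_three_minors hN hij (fun e => hiJ (e ▸ hr)) (fun e => hj (e ▸ hr)) ?_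
        intro a b c
        have h₁ := idealOf_mono (U := {r, i, j}) (by grind)
          (h r (Finset.mem_insert_of_mem hr) a b c)
        have h₂ := idealOf_mono (U := {r, i, j}) (by grind)
          (w12_mem hpq (w11 (Dp (F i)) (Dp (F r))) a b c)
        convert Ideal.sub_mem _ h₂ h₁ using 1
        simp only [w12, w11, Dp]
        ring
    have hτ : ∀ k, ∃ σ τ, γ k - p * pderiv k (F i) - q' * (∏ r ∈ J, F r) * pderiv k (F j) =
        σ * F i + τ * F j := fun k => by
      rw [← mem_idealOf_pair]
      convert Ideal.add_mem _ (hpq k) (Ideal.mul_mem_right (pderiv k (F j)) _ hq') using 1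
      ring
    choose σ τ hστ using hτ
    obtain ⟨p', hp'⟩ := ih hiJ τ fun r hr a b c => by
      have hjir : j ∉ ({i, r} : Finset ι) := by
        simp only [Finset.mem_insert, Finset.mem_singleton, not_or]
        exact ⟨hij.symm, fun e => hj (e ▸ hr)⟩
      refine mem_idealOf_of_mul_mem hF (by
        have := Finset.card_le_two (a := i) (b := r)
        omega) hjir ?_
      have h₁ := h r (Finset.mem_insert_of_mem hr) a b c
      have hprod : ∏ r ∈ J, F r ∈ idealOf F {i, r} := by
        rw [← Finset.mul_prod_erase J F hr]
        exact Ideal.mul_mem_right _ _ (mem_idealOf (by simp))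
      have h₂ := Ideal.mul_mem_left _ (q' * w12 (Dp (F j)) (w11 (Dp (F i)) (Dp (F r))) a b c) hprod
      have h₃ := Ideal.mul_mem_left _ (w12 σ (w11 (Dp (F i)) (Dp (F r))) a b c)
        (mem_idealOf (F := F) (T := {i, r}) (i := i) (by simp))
      convert Ideal.sub_mem _ (Ideal.sub_mem _ h₁ h₂) h₃ using 1
      have hγ : ∀ k, γ k = p * pderiv k (F i) + q' * (∏ r ∈ J, F r) * pderiv k (F j) +
        σ k * F i + τ k * F j := fun k => by linear_combination hστ k
      simp only [w12, w11, Dp, hγ]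
      ring
    refine ⟨p + F j * p', fun k => ?_⟩
    have hFj := mem_pow_idealOfVars_of_isHomogeneous (hFh j)
    have h₁ : F j * (τ k - p' * pderiv k (F i)) ∈ Ideal.span {F i} ⊔
        idealOfVars (Fin N) ℂ ^ (∑ j ∈ insert j J, dd j - 1) := by
      obtain ⟨u, hu, v, hv, huv⟩ := Submodule.mem_sup.mp (hp' k)
      rw [← huv, mul_add]
      refine Submodule.add_mem_sup (Ideal.mul_mem_left _ _ hu) ?_
      refine Ideal.pow_le_pow_right ?_ (pow_add (idealOfVars (Fin N) ℂ) _ _ ▸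
        Ideal.mul_mem_mul hFj hv)
      rw [Finset.sum_insert hj]; omega
    have h₂ : q' * ((∏ r ∈ J, F r) * pderiv k (F j)) ∈ Ideal.span {F i} ⊔
        idealOfVars (Fin N) ℂ ^ (∑ j ∈ insert j J, dd j - 1) := by
      refine Ideal.mul_mem_left _ _ (Ideal.mem_sup_right ?_)
      refine Ideal.pow_le_pow_right ?_ (mem_pow_idealOfVars_of_isHomogeneous
        ((IsHomogeneous.prod J F dd fun r _ => hFh r).mul (hFh j).pderiv))
      rw [Finset.sum_insert hj]; omega
    have h₃ : σ k * F i ∈ Ideal.span {F i} ⊔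
        idealOfVars (Fin N) ℂ ^ (∑ j ∈ insert j J, dd j - 1) :=
      Ideal.mem_sup_left (Ideal.mul_mem_left _ _ (Ideal.mem_span_singleton_self _))
    convert Ideal.add_mem _ (Ideal.add_mem _ h₁ h₂) h₃ using 1
    linear_combination hστ k

end Structure

section Tangent

variable {N : ℕ}

lemma pderiv_comm (k l : Fin N) (f : S N) : pderiv k (pderiv l f) = pderiv l (pderiv k f) := by
  have h : ⁅(pderiv k : Derivation ℂ (S N) (S N)), (pderiv l : Derivation ℂ (S N) (S N))⁆ = 0 := by
    refine MvPolynomial.derivation_ext fun a => ?_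
    classical
    simp [Derivation.commutator_apply, pderiv_X, Pi.single_apply, apply_ite]
  have := DFunLike.congr_fun h f
  rwa [Derivation.commutator_apply, Derivation.zero_apply, sub_eq_zero] at this

lemma TangentZero.mul_mem_span {f u : S N} {c : ℂ} {ω α ρ σ γ : Form1 N}
    (hω : ∀ k, ω k = C c * u * pderiv k f + f * ρ k) (hα : ∀ k, α k = u * γ k + f * σ k)
    (h : TangentZero ω α) (i j k : Fin N) :
    u * (C c * u * w12 (Dp f) (extD γ) i j k + w12 γ (w11 (Dp f) ρ) i j k) ∈
      Ideal.span {f} := by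
  rw [Ideal.mem_span_singleton']
  refine ⟨-(w12 ρ (extD α) i j k + C c * u * w12 (Dp f) (extD σ) i j k + w12 σ (extD ω) i j k +
    u * w12 γ (extD ρ) i j k), ?_⟩
  have hdα : ∀ k l, extD α k l = pderiv k u * γ l - pderiv l u * γ k + u * extD γ k l +
      (pderiv k f * σ l - pderiv l f * σ k) + f * extD σ k l := fun k l => by
    simp only [extD, hα, map_add, Derivation.leibniz, smul_eq_mul]
    ring
  have hdω : ∀ k l, extD ω k l = C c * (pderiv k u * pderiv l f - pderiv l u * pderiv k f) +
      (pderiv k f * ρ l - pderiv l f * ρ k) + f * extD ρ k l := fun k l => by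
    simp only [extD, hω, map_add, Derivation.leibniz, smul_eq_mul, pderiv_C, pderiv_comm l k f]
    ring
  have hijk := h i j k
  simp only [w12, hdα, hdω, hω, hα] at hijk
  simp only [w12, w11, hdα, hdω, Dp]
  linear_combination -hijk

end Tangent

section LogForm

variable {N m : ℕ} {F : Fin m → S N}

lemma Fhat_eq_mul_left (F : Fin m → S N) {i j : Fin m} (hij : i ≠ j) :
    Fhat F i = F j * Fhat2 F i j :=
  (Finset.mul_prod_erase (Finset.univ.erase i) F (by simpa using hij.symm)).symm

lemma Fhat_eq_mul_right (F : Fin m → S N) {i j : Fin m} (hij : i ≠ j) :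
    Fhat F j = F i * Fhat2 F i j := by
  rw [Fhat_eq_mul_left F hij.symm, Fhat2, Fhat2, Finset.erase_right_comm]

lemma GeneralPosition.transverse (h : GeneralPosition F) : Transverse F := h.2

/-- The residue condition on `γᵢ` along `Fᵢ = Fⱼ = 0` imposed by tangency. -/
lemma TangentZero.w12_mem_idealOf {lam : Fin m → ℂ} {α : Form1 N} (hF : Transverse F)
    (hN : 3 ≤ N) (hlam0 : ∀ i, lam i ≠ 0) (ht : TangentZero (logForm lam F) α)
    {γ : Fin m → Form1 N} (hαγ : ∀ k, α k = ∑ i, Fhat F i * γ i k) {i j : Fin m} (hij : i ≠ j)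
    (a b c : Fin N) :
    w12 (γ i) (w11 (Dp (F i)) (Dp (F j))) a b c ∈ idealOf F {i, j} := by
  let ρ : Form1 N := fun k =>
    ∑ l ∈ Finset.univ.erase i, C (lam l) * Fhat2 F i l * pderiv k (F l)
  let σ : Form1 N := fun k => ∑ l ∈ Finset.univ.erase i, Fhat2 F i l * γ l k
  have hω : ∀ k, logForm lam F k = C (lam i) * Fhat F i * pderiv k (F i) + F i * ρ k := by
    intro k
    rw [logForm, ← Finset.add_sum_erase _ _ (Finset.mem_univ i), Finset.mul_sum]
    congr 1
    refine Finset.sum_congr rfl fun l hl => ?_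
    rw [Fhat_eq_mul_right F (Finset.ne_of_mem_erase hl).symm]
    ring
  have hα : ∀ k, α k = Fhat F i * γ i k + F i * σ k := by
    intro k
    rw [hαγ, ← Finset.add_sum_erase _ _ (Finset.mem_univ i), Finset.mul_sum]
    congr 1
    refine Finset.sum_congr rfl fun l hl => ?_
    rw [Fhat_eq_mul_right F (Finset.ne_of_mem_erase hl).symm]
    ring
  have h₁ := ht.mul_mem_span hω hα a b c
  have h₂ : C (lam i) * Fhat F i * w12 (Dp (F i)) (extD (γ i)) a b c +
      w12 (γ i) (w11 (Dp (F i)) ρ) a b c ∈ idealOf F {i, j} := by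
    refine idealOf_mono (T := {i}) (by simp) (mem_idealOf_of_prod_mul_mem hF
      (by rw [Finset.card_singleton]; omega) (Finset.univ.erase i) (by simp) ?_)
    simpa [idealOf, Fhat] using h₁
  have hj : F j ∈ idealOf F {i, j} := mem_idealOf (by simp)
  have hρ : ∀ k, ρ k - C (lam j) * Fhat2 F i j * pderiv k (F j) ∈ idealOf F {i, j} := by
    intro k
    have hjmem : j ∈ Finset.univ.erase i := by simpa using hij.symm
    simp only [ρ]
    rw [← Finset.add_sum_erase _ _ hjmem, add_sub_cancel_left]
    refine Ideal.sum_mem _ fun l hl => Ideal.mul_mem_right _ _ (Ideal.mul_mem_left _ _ ?_)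
    rw [Fhat2, ← Finset.mul_prod_erase _ F
      (Finset.mem_erase.mpr ⟨(Finset.ne_of_mem_erase hl).symm, hjmem⟩)]
    exact Ideal.mul_mem_right _ _ hj
  have h₃ : Fhat2 F i j * (C (lam j) * w12 (γ i) (w11 (Dp (F i)) (Dp (F j))) a b c) ∈
      idealOf F {i, j} := by
    have h₄ : C (lam i) * Fhat F i * w12 (Dp (F i)) (extD (γ i)) a b c ∈ idealOf F {i, j} := by
      rw [Fhat_eq_mul_left F hij]
      exact Ideal.mul_mem_right _ _ (Ideal.mul_mem_left _ _ (Ideal.mul_mem_right _ _ hj))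
    have h₅ := w12_mem hρ (w11 (γ i) (Dp (F i))) a b c
    convert Ideal.sub_mem _ (Ideal.sub_mem _ h₂ h₄) h₅ using 1
    simp only [w12, w11, Dp]
    ring
  have h₆ := mem_idealOf_of_prod_mul_mem hF (by rw [Finset.card_pair hij]; omega)
    ((Finset.univ.erase i).erase j) (by simp) h₃
  have h₇ := Ideal.mul_mem_left _ (C (lam j)⁻¹) h₆
  rwa [← mul_assoc, ← C_mul, inv_mul_cancel₀ (hlam0 j), C_1, one_mul] at h₇

lemma eq_C_mul_of_sub_mul_mem {e : ℕ} (he : 1 ≤ e) {g f p : S N} (hg : g.IsHomogeneous (e - 1))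
    (hf : f.IsHomogeneous (e - 1)) (h : g - p * f ∈ idealOfVars (Fin N) ℂ ^ e) :
    g = C (coeff 0 p) * f := by
  have hp : p - C (coeff 0 p) ∈ idealOfVars (Fin N) ℂ ^ 1 := by
    rw [mem_pow_idealOfVars_iff']
    intro x hx
    obtain rfl : x = 0 := by simpa [Finsupp.degree_eq_zero_iff] using hx
    simp
  have hmem : g - C (coeff 0 p) * f ∈ idealOfVars (Fin N) ℂ ^ e := by
    have := Ideal.mul_mem_mul hp (mem_pow_idealOfVars_of_isHomogeneous hf)
    rw [← pow_add, Nat.add_sub_cancel' he] at this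
    convert Ideal.add_mem _ h this using 1
    ring
  have hhom : (g - C (coeff 0 p) * f).IsHomogeneous (e - 1) := hg.sub (by
    simpa using (isHomogeneous_C (Fin N) (coeff 0 p)).mul hf)
  rw [← sub_eq_zero]
  ext x
  rw [coeff_zero]
  by_contra hx
  have h₁ := (mem_pow_idealOfVars_iff _ _).mp hmem x (mem_support_iff.mpr hx)
  have h₂ : x.degree = e - 1 := by
    by_contra hne; exact hx (hhom.coeff_eq_zero hne)
  omega

lemma radial_pderiv {f : S N} {e : ℕ} (hf : f.IsHomogeneous e) :
    ∑ k, X k * pderiv k f = C (e : ℂ) * f := by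
  rw [hf.sum_X_mul_pderiv]
  simp [nsmul_eq_mul]

end LogForm

/-- Balanced case: if `2dᵢ < d` for all `i` and `α ∈ T(ω)` is of the form `∑ F̂ᵢ γᵢ`
with `γᵢ` homogeneous of degree `dᵢ`, then `α = ∑ λ'ᵢ F̂ᵢ dFᵢ` for some `λ'` with
`∑ dᵢ λ'ᵢ = 0`; in particular `α` lies in the image of `dμ(λ,F)`. -/
theorem statement17 (n m d : ℕ) (hn : 3 ≤ n) (dd : Fin m → ℕ) (lam : Fin m → ℂ)
    (F : Fin m → S (n+1))
    (hd : ∀ i, 1 ≤ dd i) (hsum : ∑ i, dd i = d)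
    (hbal : ∀ i, 2 * dd i < d)
    (hFh : ∀ i, (F i).IsHomogeneous (dd i)) (hgen : GeneralPosition F)
    (hlam : ∀ i j, i ≠ j → lam i ≠ lam j) (hlam0 : ∀ i, lam i ≠ 0)
    (hlamd : ∑ i, (dd i : ℂ) * lam i = 0)
    (α : Form1 (n+1)) (hαh : IsHomog1 α d) (hαp : radial α = 0)
    (ht : TangentZero (logForm lam F) α)
    (γ : Fin m → Form1 (n+1)) (hγ : ∀ i, IsHomog1 (γ i) (dd i))
    (hαγ : ∀ k, α k = ∑ i, Fhat F i * γ i k) :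
    ∃ lam' : Fin m → ℂ, (∑ i, (dd i : ℂ) * lam' i = 0) ∧
      ∀ k, α k = ∑ i, C (lam' i) * Fhat F i * pderiv k (F i) := by
  have hF := hgen.transverse
  have hres : ∀ i, ∃ c : ℂ, ∀ k, γ i k = C c * pderiv k (F i) := by
    intro i
    obtain ⟨p, hp⟩ := hF.exists_sub_mul_pderiv_mem (by omega) hFh (Finset.univ.erase i) (by simp)
      (γ i) fun j hj => ht.w12_mem_idealOf hF (by omega) hlam0 hαγ (Finset.ne_of_mem_erase hj).symm
    refine ⟨coeff 0 p, fun k => eq_C_mul_of_sub_mul_mem (hd i) (hγ i k) (hFh i).pderiv ?_⟩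
    refine (sup_le ?_ (Ideal.pow_le_pow_right ?_) : Ideal.span {F i} ⊔ _ ≤ _) (hp k)
    · exact (Ideal.span_singleton_le_iff_mem _).mpr (mem_pow_idealOfVars_of_isHomogeneous (hFh i))
    · have := Finset.add_sum_erase Finset.univ dd (Finset.mem_univ i)
      have := hbal i
      omega
  choose lam' hlam' using hres
  have hα : ∀ k, α k = ∑ i, C (lam' i) * Fhat F i * pderiv k (F i) := fun k => by
    rw [hαγ]
    refine Finset.sum_congr rfl fun i _ => ?_
    rw [hlam']
    ring
  refine ⟨lam', ?_, hα⟩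
  have hprod : C (∑ i, (dd i : ℂ) * lam' i) * ∏ i, F i = 0 := by
    rw [← hαp, radial, map_sum, Finset.sum_mul]
    simp only [hα, Finset.mul_sum]
    rw [Finset.sum_comm]
    refine Finset.sum_congr rfl fun i _ => ?_
    rw [← Finset.mul_prod_erase _ F (Finset.mem_univ i), C_mul]
    have := radial_pderiv (hFh i)
    calc _ = C (lam' i) * Fhat F i * (C (dd i : ℂ) * F i) := by rw [Fhat]; ring
      _ = _ := by
        rw [← this, Finset.mul_sum]
        exact Finset.sum_congr rfl fun k _ => by ring
  rcases mul_eq_zero.mp hprod with h | h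
  · exact (C_injective (Fin (n + 1)) ℂ) (by rw [h, C_0])
  · obtain ⟨i, -, hi⟩ := Finset.prod_eq_zero_iff.mp h
    exact ((hgen.1 i).ne_zero hi).elim

end LogStab
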